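/- arXiv:1202.0668 — 3 statements merged into one kernel-verified Lean document; each statement's English description precedes it below -/
import Mathlib

section
/- If M = m − 2n ∉ −2ℕ, the space of super polynomials decomposes as a direct sum P = ⊕_{j≥0} ⊕_{k≥0} R^{2j} H_k, where R² = Σᵢ xᵢ² − Σⱼ x'_{2j-1}x'_{2j} and H_k are the spherical harmonics of degree k (Fischer decomposition). -/
open scoped TensorProduct
open MvPolynomial
set_option synthInstance.maxHeartbeats 1000000
set_option maxHeartbeats 1000000

noncomputable section

/-- The Grassmann algebra on `N` anticommuting generators, modelled as the
exterior algebra of `ℝ^N`. -/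
abbrev GrassAlg (N : ℕ) : Type _ := ExteriorAlgebra ℝ (Fin N → ℝ)

/-- The Grassmann generators `x'_j`. -/
def gGen {N : ℕ} (j : Fin N) : GrassAlg N := ExteriorAlgebra.ι ℝ (Pi.single j 1)

/-- The (left) Grassmann derivative `∂_{x'_j}`, an odd derivation of the Grassmann
algebra, realized as left contraction with the `j`-th dual basis vector. -/
def gDer {N : ℕ} (j : Fin N) : GrassAlg N →ₗ[ℝ] GrassAlg N :=
  CliffordAlgebra.contractLeft (LinearMap.proj j)

/-- The index `2j-1` (1-based), i.e. `2j` (0-based). -/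
def fi1 {n : ℕ} (j : Fin n) : Fin (2 * n) := ⟨2 * j.1, by have := j.isLt; omega⟩

/-- The index `2j` (1-based), i.e. `2j+1` (0-based). -/
def fi2 {n : ℕ} (j : Fin n) : Fin (2 * n) := ⟨2 * j.1 + 1, by have := j.isLt; omega⟩

/-- `θ² = - Σ_j x'_{2j-1} x'_{2j}`. -/
def thetaSq (n : ℕ) : GrassAlg (2 * n) :=
  - ∑ j : Fin n, gGen (fi1 j) * gGen (fi2 j)

/-- The fermionic Laplacian `∇²_f = -4 Σ_j ∂_{x'_{2j-1}} ∂_{x'_{2j}}`. -/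
def fLap (n : ℕ) : Module.End ℝ (GrassAlg (2 * n)) :=
  -(4 : ℝ) • ∑ j : Fin n, gDer (fi1 j) * gDer (fi2 j)

/-- The fermionic Euler operator `𝔼_f = Σ_j x'_j ∂_{x'_j}`. -/
def fEuler (N : ℕ) : Module.End ℝ (GrassAlg N) :=
  ∑ j : Fin N, LinearMap.mulLeft ℝ (gGen j) * gDer j

/-- Fermionic spherical harmonics of degree `k`. -/
def fHarm (n k : ℕ) : Submodule ℝ (GrassAlg (2 * n)) :=
  Module.End.eigenspace (fEuler (2 * n)) (k : ℝ) ⊓ LinearMap.ker (fLap n)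

/-- The algebra of super polynomials `P = ℝ[x_1,…,x_m] ⊗ Λ_{2n}`. -/
abbrev SP (m n : ℕ) : Type _ := MvPolynomial (Fin m) ℝ ⊗[ℝ] GrassAlg (2 * n)

variable (m n : ℕ)

/-- Multiplication by the bosonic variable `x_i`. -/
def bvar (i : Fin m) : Module.End ℝ (SP m n) :=
  LinearMap.rTensor _ (LinearMap.mulLeft ℝ (X i))

/-- The bosonic derivative `∂_{x_i}`. -/
def bder (i : Fin m) : Module.End ℝ (SP m n) :=
  LinearMap.rTensor _ (pderiv i).toLinearMap

/-- Multiplication by the fermionic variable `x'_j`. -/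
def fvar (j : Fin (2 * n)) : Module.End ℝ (SP m n) :=
  LinearMap.lTensor _ (LinearMap.mulLeft ℝ (gGen j))

/-- The fermionic derivative `∂_{x'_j}` on super polynomials. -/
def fderSP (j : Fin (2 * n)) : Module.End ℝ (SP m n) :=
  LinearMap.lTensor _ (gDer j)

/-- The super Laplace operator `∇² = Σ_i ∂²_{x_i} - 4 Σ_j ∂_{x'_{2j-1}} ∂_{x'_{2j}}`. -/
def superLap : Module.End ℝ (SP m n) :=
  ∑ i : Fin m, bder m n i * bder m n i
    - (4 : ℝ) • ∑ j : Fin n, fderSP m n (fi1 j) * fderSP m n (fi2 j)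

/-- The super Euler operator `𝔼 = Σ_i x_i ∂_{x_i} + Σ_j x'_j ∂_{x'_j}`. -/
def superEuler : Module.End ℝ (SP m n) :=
  ∑ i : Fin m, bvar m n i * bder m n i + ∑ j : Fin (2 * n), fvar m n j * fderSP m n j

/-- The generalized norm squared `R² = Σ_i x_i² - Σ_j x'_{2j-1} x'_{2j}`. -/
def rSq : SP m n := (∑ i : Fin m, X i * X i) ⊗ₜ[ℝ] 1 + 1 ⊗ₜ[ℝ] thetaSq n

/-- Multiplication by `R²`. -/
def mulRSq : Module.End ℝ (SP m n) := LinearMap.mulLeft ℝ (rSq m n)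

/-- Super polynomials of homogeneous degree `k` (eigenspace of the Euler operator). -/
def Pdeg (k : ℕ) : Submodule ℝ (SP m n) :=
  Module.End.eigenspace (superEuler m n) (k : ℝ)

/-- Spherical harmonics of degree `k`: degree-`k` null-solutions of `∇²`. -/
def Harm (k : ℕ) : Submodule ℝ (SP m n) :=
  Pdeg m n k ⊓ LinearMap.ker (superLap m n)

/-- Evaluation at the origin: the scalar part of a super polynomial. -/
def scalarPart : SP m n →ₐ[ℝ] ℝ :=
  Algebra.TensorProduct.productMap (aeval fun _ => (0 : ℝ)) ExteriorAlgebra.algebraMapInv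

/-- Parity `[i]` of the super coordinates: `0` for bosonic, `1` for fermionic. -/
def par (i : Fin (m + 2 * n)) : ℕ := if i.1 < m then 0 else 1

/-- The orthosymplectic metric `g^{ij}` (identity bosonic block, `J`-type fermionic
block with entries `∓ 1/2`). -/
def gUp (i j : Fin (m + 2 * n)) : ℝ :=
  if i.1 < m ∧ j.1 < m then (if i = j then 1 else 0)
  else if m ≤ i.1 ∧ j.1 = i.1 + 1 ∧ (i.1 - m) % 2 = 0 then -(1 / 2)
  else if m ≤ j.1 ∧ i.1 = j.1 + 1 ∧ (j.1 - m) % 2 = 0 then 1 / 2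
  else 0

/-- The inverse orthosymplectic metric `g_{ij}`. -/
def gDown (i j : Fin (m + 2 * n)) : ℝ :=
  if i.1 < m ∧ j.1 < m then (if i = j then 1 else 0)
  else if m ≤ i.1 ∧ j.1 = i.1 + 1 ∧ (i.1 - m) % 2 = 0 then 2
  else if m ≤ j.1 ∧ i.1 = j.1 + 1 ∧ (j.1 - m) % 2 = 0 then -2
  else 0

/-- Multiplication by the super coordinate `X_i`. -/
def svar (i : Fin (m + 2 * n)) : Module.End ℝ (SP m n) :=
  if h : i.1 < m then bvar m n ⟨i.1, h⟩
  else fvar m n ⟨i.1 - m, by have := i.isLt; omega⟩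

/-- The super derivative `∂_{X_i}`. -/
def sder (i : Fin (m + 2 * n)) : Module.End ℝ (SP m n) :=
  if h : i.1 < m then bder m n ⟨i.1, h⟩
  else fderSP m n ⟨i.1 - m, by have := i.isLt; omega⟩

/-- The raised super derivative `∂_{X^j}`. -/
def sderUp (j : Fin (m + 2 * n)) : Module.End ℝ (SP m n) :=
  ∑ k : Fin (m + 2 * n), gDown m n j k • sder m n k

/-- The `osp(m|2n)` generators `L_{ij} = X_i ∂_{X^j} - (-1)^{[i][j]} X_j ∂_{X^i}`. -/
def Lgen (i j : Fin (m + 2 * n)) : Module.End ℝ (SP m n) :=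
  svar m n i * sderUp m n j
    - ((-1 : ℝ) ^ (par m n i * par m n j)) • (svar m n j * sderUp m n i)

/-- The Laplace–Beltrami operator `Δ_LB = R²∇² - 𝔼(M - 2 + 𝔼)`. -/
def lapBeltrami : Module.End ℝ (SP m n) :=
  mulRSq m n * superLap m n
    - superEuler m n *
        ((((m : ℝ) - 2 * n) - 2) • (1 : Module.End ℝ (SP m n)) + superEuler m n)

/-- The bosonic Laplacian on ordinary polynomials. -/
def bLap : Module.End ℝ (MvPolynomial (Fin m) ℝ) :=
  ∑ i : Fin m, (pderiv i).toLinearMap * (pderiv i).toLinearMap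

/-! Abstract sl2 part. -/

section Abstract

variable {V : Type*} [AddCommGroup V] [Module ℝ V]

theorem abs_E_pow (E R : Module.End ℝ V) (hER : ∀ v, E (R v) = R (E v) + (2 : ℝ) • R v)
    (k : ℝ) (h : V) (hh : E h = k • h) (j : ℕ) :
    E ((R ^ j) h) = (k + 2 * j) • (R ^ j) h := by
  induction j with
  | zero => simpa using hh
  | succ j ih =>
    rw [pow_succ', Module.End.mul_apply, hER, ih, map_smul, ← add_smul]
    congr 1
    push_cast
    ring

theorem abs_L_pow (E R L : Module.End ℝ V) (M : ℝ)
    (hLR : ∀ v, L (R v) = R (L v) + (4 : ℝ) • E v + (2 * M) • v)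
    (hER : ∀ v, E (R v) = R (E v) + (2 : ℝ) • R v)
    (k : ℝ) (h : V) (hh : E h = k • h) (hL : L h = 0) (j : ℕ) :
    L ((R ^ (j + 1)) h) = (2 * ((j : ℝ) + 1) * (2 * k + 2 * j + M)) • (R ^ j) h := by
  induction j with
  | zero =>
    simp only [zero_add, pow_one, pow_zero, Module.End.one_apply]
    rw [hLR, hL, hh, map_zero, zero_add, smul_smul, ← add_smul]
    congr 1
    push_cast
    ring
  | succ j ih =>
    rw [pow_succ', Module.End.mul_apply, hLR, ih, map_smul, abs_E_pow E R hER k h hh,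
      ← Module.End.mul_apply R, ← pow_succ', smul_smul, ← add_smul, ← add_smul]
    congr 1
    push_cast
    ring

theorem abs_fischer (E R L : Module.End ℝ V) (M : ℝ)
    (hLR : ∀ v, L (R v) = R (L v) + (4 : ℝ) • E v + (2 * M) • v)
    (hER : ∀ v, E (R v) = R (E v) + (2 : ℝ) • R v)
    (hEL : ∀ v, E (L v) = L (E v) - (2 : ℝ) • L v)
    (htop : ⨆ k : ℕ, Module.End.eigenspace E (k : ℝ) = ⊤)
    (hM : ∀ j : ℕ, M ≠ -2 * j) :
    DirectSum.IsInternal (fun p : ℕ × ℕ =>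
      Submodule.map (R ^ p.1) (Module.End.eigenspace E (p.2 : ℝ) ⊓ LinearMap.ker L)) := by
  have hmem : ∀ (k : ℝ) (v : V), v ∈ Module.End.eigenspace E k ↔ E v = k • v :=
    fun k v => Module.End.mem_eigenspace_iff
  apply DirectSum.isInternal_submodule_of_iSupIndep_of_iSup_eq_top
  · -- independence: joint eigenspaces of `E` and `R L`
    let f : Bool → Module.End ℝ V := fun b => if b then E else R * L
    have hcomm : Commute E (R * L) := by
      ext v
      simp only [Module.End.mul_apply, hER, hEL, map_sub, map_smul]
      abel
    have hf : ∀ i j, Commute (f i) (f j) := by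
      intro i j
      cases i <;> cases j <;> simp only [f] <;>
        first | exact Commute.refl _ | exact hcomm | exact hcomm.symm
    have hind := Module.End.independent_iInf_maxGenEigenspace_of_forall_mapsTo f
      (fun i j φ => Module.End.mapsTo_maxGenEigenspace_of_comm (hf j i) φ)
    let χ : ℕ × ℕ → (Bool → ℝ) := fun p b =>
      if b then (p.2 : ℝ) + 2 * p.1 else 2 * (p.1 : ℝ) * (2 * p.2 + 2 * p.1 - 2 + M)
    have hχ : Function.Injective χ := by
      rintro ⟨j, k⟩ ⟨j', k'⟩ h
      have h1 := congrFun h true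
      have h2 := congrFun h false
      simp only [χ, if_true, Bool.false_eq_true, if_false] at h1 h2
      have h1' : k + 2 * j = k' + 2 * j' := by exact_mod_cast h1
      by_cases hj : j = j'
      · subst hj
        have : k = k' := by omega
        rw [this]
      · exfalso
        have hkk : (k : ℝ) = k' + 2 * j' - 2 * j := by linarith
        have hle : j + j' + 1 ≤ k' + 2 * j' := by omega
        obtain ⟨t, ht⟩ := Nat.exists_eq_add_of_le hle
        have htR : (k' : ℝ) + 2 * j' = j + j' + 1 + t := by exact_mod_cast ht
        have hz : ((j : ℝ) - j') * (M + 2 * t) = 0 := by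
          have hk' : (k' : ℝ) = j + j' + 1 + t - 2 * j' := by linarith
          rw [hkk, hk'] at h2
          linear_combination h2 / 2
        rcases mul_eq_zero.mp hz with hz | hz
        · exact hj (by exact_mod_cast sub_eq_zero.mp hz)
        · exact hM t (by linarith)
    refine (hind.comp hχ).mono ?_
    rintro ⟨j, k⟩ v hv
    obtain ⟨h, ⟨hE, hL⟩, rfl⟩ := hv
    have hE' := (hmem _ _).mp hE
    have hL' : L h = 0 := hL
    simp only [Function.comp]
    rw [Submodule.mem_iInf]
    intro b
    have hev : f b ((R ^ j) h) = χ (j, k) b • (R ^ j) h := by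
      cases b
      · simp only [f, χ, Bool.false_eq_true, if_false, Module.End.mul_apply]
        cases j with
        | zero => simp [hL']
        | succ j =>
          rw [abs_L_pow E R L M hLR hER k h hE' hL' j, map_smul, ← Module.End.mul_apply R,
            ← pow_succ']
          congr 1
          push_cast
          ring
      · simp only [f, χ, if_true]
        exact abs_E_pow E R hER k h hE' j
    have hmm := (Module.End.mem_eigenspace_iff (f := f b)).mpr hev
    exact (Module.End.genEigenspace (f b) (χ (j, k) b)).monotone le_top hmm
  · -- spanning
    have hneg : ∀ μ : ℝ, (∀ k : ℕ, μ ≠ k) → ∀ v, E v = μ • v → v = 0 := by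
      intro μ hμ v hv
      have hd := (Module.End.eigenspaces_iSupIndep E) μ
      have hle : (⊤ : Submodule ℝ V) ≤ ⨆ ν, ⨆ (_ : ν ≠ μ), Module.End.eigenspace E ν := by
        rw [← htop]
        refine iSup_le fun k => ?_
        exact le_iSup₂_of_le (k : ℝ) (hμ k).symm le_rfl
      exact (Submodule.disjoint_def.mp hd) v ((hmem _ _).mpr hv) (hle trivial)
    let S : ℕ → Submodule ℝ V := fun d => ⨆ p : {p : ℕ × ℕ // p.2 + 2 * p.1 = d},
        Submodule.map (R ^ p.1.1) (Module.End.eigenspace E (p.1.2 : ℝ) ⊓ LinearMap.ker L)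
    have hSV : ∀ d, S d ≤ Module.End.eigenspace E (d : ℝ) := by
      intro d
      refine iSup_le ?_
      rintro ⟨⟨j, k⟩, hp⟩ v ⟨h, ⟨hE, hL⟩, rfl⟩
      rw [hmem, abs_E_pow E R hER k h ((hmem _ _).mp hE) j]
      congr 1
      exact_mod_cast hp
    have hLS : ∀ d, S d ≤ Submodule.map L (S (d + 2)) := by
      intro d
      refine iSup_le ?_
      rintro ⟨⟨j, k⟩, hp⟩ v ⟨h, ⟨hE, hL⟩, rfl⟩
      have hp' : k + 2 * j = d := hp
      have hc : (2 * ((j : ℝ) + 1) * (2 * k + 2 * j + M)) ≠ 0 := by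
        refine mul_ne_zero (by positivity) ?_
        intro h0
        apply hM (k + j)
        push_cast
        linarith
      refine ⟨(2 * ((j : ℝ) + 1) * (2 * k + 2 * j + M))⁻¹ • (R ^ (j + 1)) h, ?_, ?_⟩
      · refine Submodule.smul_mem _ _ ?_
        refine Submodule.mem_iSup_of_mem ⟨(j + 1, k), by simp only; omega⟩ ?_
        exact ⟨h, ⟨hE, hL⟩, rfl⟩
      · rw [map_smul, abs_L_pow E R L M hLR hER k h ((hmem _ _).mp hE) hL j, smul_smul,
          inv_mul_cancel₀ hc, one_smul]
    have hH : ∀ d v, E v = ((d : ℕ) : ℝ) • v → L v = 0 → v ∈ S d := by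
      intro d v hv hL
      refine Submodule.mem_iSup_of_mem ⟨(0, d), by simp⟩ ?_
      exact ⟨v, ⟨(hmem _ _).mpr hv, hL⟩, by simp⟩
    have key : ∀ d : ℕ, ∀ v, E v = (d : ℝ) • v → v ∈ S d := by
      intro d
      induction d using Nat.strong_induction_on with
      | _ d ih =>
        intro v hv
        have hLv : E (L v) = ((d : ℝ) - 2) • L v := by
          rw [hEL, hv, map_smul, sub_smul]
        by_cases hd : d < 2
        · refine hH d v hv (hneg _ ?_ _ hLv)
          intro k hk
          have hk0 : (0 : ℝ) ≤ k := Nat.cast_nonneg k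
          have hd' : (d : ℝ) < 2 := by exact_mod_cast hd
          linarith
        · obtain ⟨e, rfl⟩ : ∃ e, d = e + 2 := ⟨d - 2, by omega⟩
          have h1 : L v ∈ S e := by
            apply ih e (by omega)
            rw [hLv]
            congr 1
            push_cast
            ring
          obtain ⟨s, hs, hsL⟩ := hLS e h1
          have h2 : v - s ∈ S (e + 2) := by
            apply hH
            · rw [map_sub, hv, (hmem _ _).mp (hSV _ hs), smul_sub]
            · rw [map_sub, hsL, sub_self]
          simpa using Submodule.add_mem _ h2 hs
    rw [eq_top_iff, ← htop]
    refine iSup_le fun d v hv => ?_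
    have h1 : v ∈ S d := key d v ((hmem _ _).mp hv)
    have h2 : S d ≤ ⨆ p : ℕ × ℕ,
        Submodule.map (R ^ p.1) (Module.End.eigenspace E (p.2 : ℝ) ⊓ LinearMap.ker L) :=
      iSup_le fun p => le_iSup (fun p : ℕ × ℕ => Submodule.map (R ^ p.1)
        (Module.End.eigenspace E (p.2 : ℝ) ⊓ LinearMap.ker L)) p.1
    exact h2 h1

end Abstract

theorem fi1_inj {n : ℕ} {i j : Fin n} : (fi1 i = fi1 j) ↔ i = j := by
  simp [fi1, Fin.ext_iff]

theorem fi2_inj {n : ℕ} {i j : Fin n} : (fi2 i = fi2 j) ↔ i = j := by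
  simp [fi2, Fin.ext_iff]

theorem fi1_ne_fi2 {n : ℕ} {i j : Fin n} : (fi1 i = fi2 j) ↔ False := by
  simp only [fi1, fi2, Fin.ext_iff, iff_false]; omega

theorem fi2_ne_fi1 {n : ℕ} {i j : Fin n} : (fi2 i = fi1 j) ↔ False := by
  simp only [fi1, fi2, Fin.ext_iff, iff_false]; omega

theorem sum_fi {n : ℕ} {A : Type*} [AddCommMonoid A] (g : Fin (2 * n) → A) :
    ∑ j, g j = ∑ j : Fin n, (g (fi1 j) + g (fi2 j)) := by
  have e := Equiv.sum_comp (finProdFinEquiv (m := n) (n := 2))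
    (fun j => g (Fin.cast (mul_comm n 2) j))
  have e2 := Equiv.sum_comp (finCongr (mul_comm n 2)) g
  rw [← e2]
  refine e.symm.trans ?_
  rw [Fintype.sum_prod_type]
  refine Finset.sum_congr rfl fun j _ => ?_
  rw [Fin.sum_univ_two]
  congr 2 <;> simp [fi1, fi2, finProdFinEquiv, add_comm]

/-- If `A_j x = x A_j + δ_{ji} B` for all `j`, then the sum of the `A_j` satisfies
the same with `B`. -/
theorem sum_comm_delta {A ι : Type*} [Ring A] [Fintype ι] [DecidableEq ι] (F : ι → A) (x B : A)
    (i : ι) (h : ∀ j, F j * x = x * F j + if j = i then B else 0) :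
    (∑ j, F j) * x = x * (∑ j, F j) + B := by
  rw [Finset.sum_mul, Finset.mul_sum, Finset.sum_congr rfl fun j _ => h j,
    Finset.sum_add_distrib]
  simp

theorem sum_comm_zero {A ι : Type*} [Ring A] [Fintype ι] (F : ι → A) (x : A)
    (h : ∀ j, F j * x = x * F j) : (∑ j, F j) * x = x * (∑ j, F j) := by
  rw [Finset.sum_mul, Finset.mul_sum, Finset.sum_congr rfl fun j _ => h j]

theorem comm_mul_aux {A : Type*} [Ring A] (E x y a b : A) (hx : E * x = x * E + a)
    (hy : E * y = y * E + b) : E * (x * y) = x * y * E + (a * y + x * b) := by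
  rw [← mul_assoc, hx, add_mul, mul_assoc, hy, mul_add]
  noncomm_ring

/-- The Weyl–Clifford relations among super coordinates and super derivatives. -/
structure SuperWeyl {m n : ℕ} {A : Type*} [Ring A] (b db : Fin m → A)
    (f df : Fin (2 * n) → A) : Prop where
  db_b : ∀ i j, db i * b j = b j * db i + if i = j then 1 else 0
  db_db : ∀ i j, db i * db j = db j * db i
  b_b : ∀ i j, b i * b j = b j * b i
  df_f_add : ∀ i j, df i * f j + f j * df i = if i = j then 1 else 0
  df_df_add : ∀ i j, df i * df j + df j * df i = 0
  f_f_add : ∀ i j, f i * f j + f j * f i = 0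
  db_f : ∀ i j, db i * f j = f j * db i
  db_df : ∀ i j, db i * df j = df j * db i
  b_f : ∀ i j, b i * f j = f j * b i
  b_df : ∀ i j, b i * df j = df j * b i

namespace SuperWeyl

variable {m n : ℕ} {A : Type*} [Ring A] [Algebra ℝ A] {b db : Fin m → A} {f df : Fin (2 * n) → A}

theorem df_f (W : SuperWeyl b db f df) (i j) :
    df i * f j = (if i = j then 1 else 0) - f j * df i :=
  eq_sub_of_add_eq (W.df_f_add i j)

theorem df_df (W : SuperWeyl b db f df) (i j) : df i * df j = -(df j * df i) :=
  eq_neg_of_add_eq_zero_left (W.df_df_add i j)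

theorem f_f (W : SuperWeyl b db f df) (i j) : f i * f j = -(f j * f i) :=
  eq_neg_of_add_eq_zero_left (W.f_f_add i j)

theorem E_b (W : SuperWeyl b db f df) (E : A)
    (hE : E = ∑ i, b i * db i + ∑ j, f j * df j) (i : Fin m) : E * b i = b i * E + b i := by
  have h1 := sum_comm_delta (fun j => b j * db j) (b i) (b i) i (by
    intro j
    rw [mul_assoc, W.db_b, mul_add, ← mul_assoc, W.b_b j i, mul_assoc]
    split_ifs with h <;> simp [h])
  have h2 := sum_comm_zero (fun j => f j * df j) (b i) (by
    intro j
    rw [mul_assoc, ← W.b_df, ← mul_assoc, ← W.b_f, mul_assoc])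
  rw [hE, add_mul, mul_add, h1, h2]
  abel

theorem E_db (W : SuperWeyl b db f df) (E : A)
    (hE : E = ∑ i, b i * db i + ∑ j, f j * df j) (i : Fin m) :
    E * db i = db i * E + -db i := by
  have h1 := sum_comm_delta (fun j => b j * db j) (db i) (-db i) i (by
    intro j
    rw [mul_assoc, W.db_db, ← mul_assoc, ← mul_assoc, W.db_b, add_mul]
    by_cases h : j = i
    · subst h; simp
    · simp [h, Ne.symm h])
  have h2 := sum_comm_zero (fun j => f j * df j) (db i) (by
    intro j
    rw [mul_assoc, ← W.db_df, ← mul_assoc, ← W.db_f, mul_assoc])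
  rw [hE, add_mul, mul_add, h1, h2]
  abel

theorem E_f (W : SuperWeyl b db f df) (E : A)
    (hE : E = ∑ i, b i * db i + ∑ j, f j * df j) (i : Fin (2 * n)) :
    E * f i = f i * E + f i := by
  have h1 := sum_comm_delta (fun j => f j * df j) (f i) (f i) i (by
    intro j
    rw [mul_assoc, W.df_f, mul_sub, ← mul_assoc, W.f_f j i, neg_mul, mul_assoc]
    split_ifs with h <;> simp [h, add_comm])
  have h2 := sum_comm_zero (fun j => b j * db j) (f i) (by
    intro j
    rw [mul_assoc, W.db_f, ← mul_assoc, W.b_f, mul_assoc])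
  rw [hE, add_mul, mul_add, h1, h2]
  abel

theorem E_df (W : SuperWeyl b db f df) (E : A)
    (hE : E = ∑ i, b i * db i + ∑ j, f j * df j) (i : Fin (2 * n)) :
    E * df i = df i * E + -df i := by
  have h1 := sum_comm_delta (fun j => f j * df j) (df i) (-df i) i (by
    intro j
    rw [mul_assoc, W.df_df, ← mul_assoc, W.df_f, sub_mul, mul_neg, mul_assoc]
    by_cases h : j = i
    · subst h; simp; abel
    · simp [h, Ne.symm h])
  have h2 := sum_comm_zero (fun j => b j * db j) (df i) (by
    intro j
    rw [mul_assoc, W.db_df, ← mul_assoc, W.b_df, mul_assoc])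
  rw [hE, add_mul, mul_add, h1, h2]
  abel

theorem L_b (W : SuperWeyl b db f df) (L : A)
    (hL : L = ∑ i, db i * db i - (4 : ℝ) • ∑ j : Fin n, df (fi1 j) * df (fi2 j)) (i : Fin m) :
    L * b i = b i * L + (db i + db i) := by
  have h1 := sum_comm_delta (fun j => db j * db j) (b i) (db i + db i) i (by
    intro j
    rw [mul_assoc, W.db_b, mul_add, ← mul_assoc, W.db_b, add_mul, mul_assoc]
    split_ifs with h
    · subst h; simp [add_assoc]
    · simp)
  have h2 := sum_comm_zero (fun j : Fin n => df (fi1 j) * df (fi2 j)) (b i) (by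
    intro j
    rw [mul_assoc, ← W.b_df, ← mul_assoc, ← W.b_df, mul_assoc])
  rw [hL, sub_mul, mul_sub, h1, smul_mul_assoc, h2, mul_smul_comm]
  abel

theorem L_f1 (W : SuperWeyl b db f df) (L : A)
    (hL : L = ∑ i, db i * db i - (4 : ℝ) • ∑ j : Fin n, df (fi1 j) * df (fi2 j)) (i : Fin n) :
    L * f (fi1 i) = f (fi1 i) * L + (4 : ℝ) • df (fi2 i) := by
  have h1 := sum_comm_delta (fun j : Fin n => df (fi1 j) * df (fi2 j))
    (f (fi1 i)) (-df (fi2 i)) i (by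
    intro j
    rw [mul_assoc, W.df_f, if_neg (by simp [fi2_ne_fi1]), zero_sub, mul_neg, ← mul_assoc,
      W.df_f, sub_mul, mul_assoc]
    simp only [fi1_inj]
    split_ifs with h
    · subst h; simp; abel
    · simp)
  have h2 := sum_comm_zero (fun j => db j * db j) (f (fi1 i)) (by
    intro j
    rw [mul_assoc, W.db_f, ← mul_assoc, W.db_f, mul_assoc])
  rw [hL, sub_mul, mul_sub, h2, smul_mul_assoc, h1, mul_smul_comm, smul_add, smul_neg]
  abel

theorem L_f2 (W : SuperWeyl b db f df) (L : A)
    (hL : L = ∑ i, db i * db i - (4 : ℝ) • ∑ j : Fin n, df (fi1 j) * df (fi2 j)) (i : Fin n) :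
    L * f (fi2 i) = f (fi2 i) * L - (4 : ℝ) • df (fi1 i) := by
  have h1 := sum_comm_delta (fun j : Fin n => df (fi1 j) * df (fi2 j))
    (f (fi2 i)) (df (fi1 i)) i (by
    intro j
    rw [mul_assoc, W.df_f, mul_sub, ← mul_assoc _ (f (fi2 i)),
      W.df_f (fi1 j), if_neg (fi1_ne_fi2 (i := j) (j := i)).mp, zero_sub, neg_mul, mul_assoc]
    simp only [fi2_inj]
    split_ifs with h
    · subst h; simp; abel
    · simp)
  have h2 := sum_comm_zero (fun j => db j * db j) (f (fi2 i)) (by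
    intro j
    rw [mul_assoc, W.db_f, ← mul_assoc, W.db_f, mul_assoc])
  rw [hL, sub_mul, mul_sub, h2, smul_mul_assoc, h1, mul_smul_comm, smul_add]
  abel

theorem L_R (W : SuperWeyl b db f df) (E L R : A)
    (hE : E = ∑ i, b i * db i + ∑ j, f j * df j)
    (hL : L = ∑ i, db i * db i - (4 : ℝ) • ∑ j : Fin n, df (fi1 j) * df (fi2 j))
    (hR : R + ∑ j : Fin n, f (fi1 j) * f (fi2 j) = ∑ i, b i * b i) :
    L * R = R * L + (4 : ℝ) • E + (2 * ((m : ℝ) - 2 * n)) • 1 := by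
  have hb : ∀ i, L * (b i * b i) = b i * b i * L
      + ((4 : ℝ) • (b i * db i) + (2 : ℝ) • 1) := by
    intro i
    rw [← mul_assoc, W.L_b L hL, add_mul, mul_assoc, W.L_b L hL, add_mul, W.db_b, if_pos rfl,
      mul_add, mul_add, ← mul_assoc]
    module
  have hf : ∀ j : Fin n, L * (f (fi1 j) * f (fi2 j)) = f (fi1 j) * f (fi2 j) * L
      + ((4 : ℝ) • 1 - (4 : ℝ) • (f (fi1 j) * df (fi1 j) + f (fi2 j) * df (fi2 j))) := by
    intro j
    rw [← mul_assoc, W.L_f1 L hL, add_mul, mul_assoc, W.L_f2 L hL, smul_mul_assoc, W.df_f,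
      if_pos rfl, mul_sub, mul_smul_comm, ← mul_assoc]
    module
  rw [eq_sub_of_add_eq hR, mul_sub, sub_mul, Finset.mul_sum, Finset.mul_sum, Finset.sum_mul,
    Finset.sum_mul, Finset.sum_congr rfl fun i _ => hb i, Finset.sum_congr rfl fun j _ => hf j, hE,
    sum_fi (fun j => f j * df j)]
  simp only [Finset.sum_add_distrib, Finset.sum_sub_distrib, ← Finset.smul_sum, Finset.sum_const,
    Finset.card_univ, Fintype.card_fin, ← Nat.cast_smul_eq_nsmul ℝ]
  module

theorem E_R (W : SuperWeyl b db f df) (E R : A)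
    (hE : E = ∑ i, b i * db i + ∑ j, f j * df j)
    (hR : R + ∑ j : Fin n, f (fi1 j) * f (fi2 j) = ∑ i, b i * b i) :
    E * R = R * E + (2 : ℝ) • R := by
  rw [eq_sub_of_add_eq hR, mul_sub, sub_mul, Finset.mul_sum, Finset.mul_sum, Finset.sum_mul,
    Finset.sum_mul,
    Finset.sum_congr rfl fun i _ => comm_mul_aux _ _ _ _ _ (W.E_b E hE i) (W.E_b E hE i),
    Finset.sum_congr rfl fun j _ => comm_mul_aux _ _ _ _ _ (W.E_f E hE (fi1 j))
      (W.E_f E hE (fi2 j))]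
  simp only [Finset.sum_add_distrib]
  module

theorem E_L (W : SuperWeyl b db f df) (E L : A)
    (hE : E = ∑ i, b i * db i + ∑ j, f j * df j)
    (hL : L = ∑ i, db i * db i - (4 : ℝ) • ∑ j : Fin n, df (fi1 j) * df (fi2 j)) :
    E * L = L * E - (2 : ℝ) • L := by
  rw [hL, mul_sub, sub_mul, mul_smul_comm, smul_mul_assoc, Finset.mul_sum, Finset.mul_sum,
    Finset.sum_mul, Finset.sum_mul,
    Finset.sum_congr rfl fun i _ => comm_mul_aux _ _ _ _ _ (W.E_db E hE i) (W.E_db E hE i),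
    Finset.sum_congr rfl fun j _ => comm_mul_aux _ _ _ _ _ (W.E_df E hE (fi1 j))
      (W.E_df E hE (fi2 j))]
  simp only [Finset.sum_add_distrib, neg_mul, mul_neg, Finset.sum_neg_distrib]
  module

end SuperWeyl

theorem gDer_gGen_mul {N : ℕ} (i j : Fin N) (w : GrassAlg N) :
    gDer i (gGen j * w) + gGen j * gDer i w = if i = j then w else 0 := by
  have h : gDer i (gGen j * w) = (if i = j then (1 : ℝ) else 0) • w - gGen j * gDer i w := by
    have := CliffordAlgebra.contractLeft_ι_mul (Q := (0 : QuadraticForm ℝ (Fin N → ℝ)))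
      (d := LinearMap.proj i) (Pi.single j (1 : ℝ)) w
    rw [LinearMap.proj_apply, Pi.single_apply] at this
    exact this
  rw [h, sub_add_cancel]
  split_ifs <;> simp

theorem superWeyl_SP : SuperWeyl (bvar m n) (bder m n) (fvar m n) (fderSP m n) where
  db_b i j := by
    refine TensorProduct.ext' fun p w => ?_
    by_cases h : i = j
    · subst h
      simp [bder, bvar, TensorProduct.add_tmul, add_comm]
    · simp [bder, bvar, h, pderiv_X_of_ne (Ne.symm h)]
  db_db i j := by
    refine TensorProduct.ext' fun p w => ?_
    simp only [bder, Module.End.mul_apply, LinearMap.rTensor_tmul]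
    congr 1
    have h : ⁅(pderiv i : Derivation ℝ (MvPolynomial (Fin m) ℝ) (MvPolynomial (Fin m) ℝ)),
        (pderiv j : Derivation ℝ (MvPolynomial (Fin m) ℝ) (MvPolynomial (Fin m) ℝ))⁆ = 0 := by
      refine MvPolynomial.derivation_ext fun k => ?_
      simp [Derivation.commutator_apply, pderiv_X, Pi.single_apply, apply_ite]
    have h2 := DFunLike.congr_fun h p
    rw [Derivation.commutator_apply] at h2
    exact sub_eq_zero.mp h2
  b_b i j := by
    refine TensorProduct.ext' fun p w => ?_
    simp [bvar, mul_left_comm]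
  df_f_add i j := by
    refine TensorProduct.ext' fun p w => ?_
    simp only [fderSP, fvar, Module.End.mul_apply, LinearMap.lTensor_tmul,
      LinearMap.mulLeft_apply, LinearMap.add_apply]
    rw [← TensorProduct.tmul_add, gDer_gGen_mul]
    split_ifs <;> simp
  df_df_add i j := by
    refine TensorProduct.ext' fun p w => ?_
    simp only [fderSP, Module.End.mul_apply, LinearMap.lTensor_tmul, LinearMap.add_apply]
    have h : gDer i (gDer j w) + gDer j (gDer i w) = 0 := by
      have := CliffordAlgebra.contractLeft_comm (Q := (0 : QuadraticForm ℝ (Fin (2 * n) → ℝ)))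
        (d := LinearMap.proj i) (d' := LinearMap.proj j) w
      exact eq_neg_iff_add_eq_zero.mp this
    rw [← TensorProduct.tmul_add, h, TensorProduct.tmul_zero, LinearMap.zero_apply]
  f_f_add i j := by
    refine TensorProduct.ext' fun p w => ?_
    simp only [fvar, Module.End.mul_apply, LinearMap.lTensor_tmul, LinearMap.add_apply,
      LinearMap.mulLeft_apply]
    have h : (gGen i * gGen j + gGen j * gGen i : GrassAlg (2 * n)) = 0 :=
      ExteriorAlgebra.ι_add_mul_swap _ _
    rw [← TensorProduct.tmul_add, ← mul_assoc, ← mul_assoc, ← add_mul, h, zero_mul,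
      TensorProduct.tmul_zero, LinearMap.zero_apply]
  db_f i j := by
    refine TensorProduct.ext' fun p w => ?_
    simp [bder, fvar]
  db_df i j := by
    refine TensorProduct.ext' fun p w => ?_
    simp [bder, fderSP]
  b_f i j := by
    refine TensorProduct.ext' fun p w => ?_
    simp [bvar, fvar]
  b_df i j := by
    refine TensorProduct.ext' fun p w => ?_
    simp [bvar, fderSP]

theorem mulRSq_eq : mulRSq m n + ∑ j : Fin n, fvar m n (fi1 j) * fvar m n (fi2 j)
    = ∑ i : Fin m, bvar m n i * bvar m n i := by
  refine TensorProduct.ext' fun p w => ?_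
  have h : thetaSq n * w + ∑ j : Fin n, gGen (fi1 j) * (gGen (fi2 j) * w) = 0 := by
    simp only [thetaSq, neg_mul, Finset.sum_mul, mul_assoc]
    exact neg_add_cancel _
  simp only [mulRSq, rSq, bvar, fvar, LinearMap.add_apply, LinearMap.sum_apply,
    LinearMap.mulLeft_apply, add_mul, Algebra.TensorProduct.tmul_mul_tmul, one_mul,
    Module.End.mul_apply, LinearMap.lTensor_tmul, LinearMap.rTensor_tmul]
  rw [← TensorProduct.tmul_sum, add_assoc, ← TensorProduct.tmul_add, h, TensorProduct.tmul_zero,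
    add_zero, Finset.sum_mul, TensorProduct.sum_tmul]
  simp only [mul_assoc]

theorem iSup_raise {V : Type*} [AddCommGroup V] [Module ℝ V] (E x : Module.End ℝ V)
    (h : E * x = x * E + x) (v : V) (hv : v ∈ ⨆ k : ℕ, Module.End.eigenspace E (k : ℝ)) :
    x v ∈ ⨆ k : ℕ, Module.End.eigenspace E (k : ℝ) := by
  have hle : (⨆ k : ℕ, Module.End.eigenspace E (k : ℝ)) ≤
      Submodule.comap x (⨆ k : ℕ, Module.End.eigenspace E (k : ℝ)) := by
    refine iSup_le fun k w hw => ?_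
    refine Submodule.mem_iSup_of_mem (k + 1) ?_
    rw [Module.End.mem_eigenspace_iff] at hw ⊢
    have := LinearMap.congr_fun h w
    simp only [Module.End.mul_apply, LinearMap.add_apply, hw, map_smul] at this
    rw [this]
    push_cast
    module
  exact hle hv

theorem iSup_Pdeg : ⨆ k : ℕ, Module.End.eigenspace (superEuler m n) (k : ℝ) = ⊤ := by
  rw [eq_top_iff]
  have h1 : (1 : MvPolynomial (Fin m) ℝ) ⊗ₜ[ℝ] (1 : GrassAlg (2 * n)) ∈
      ⨆ k : ℕ, Module.End.eigenspace (superEuler m n) (k : ℝ) := by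
    refine Submodule.mem_iSup_of_mem 0 ?_
    rw [Module.End.mem_eigenspace_iff]
    have hg : ∀ j : Fin (2 * n), gDer j (1 : GrassAlg (2 * n)) = 0 := fun j =>
      CliffordAlgebra.contractLeft_one (0 : QuadraticForm ℝ (Fin (2 * n) → ℝ)) (LinearMap.proj j)
    simp [superEuler, bvar, bder, fvar, fderSP, LinearMap.sum_apply, hg]
  have h2 : ∀ w : GrassAlg (2 * n), (1 : MvPolynomial (Fin m) ℝ) ⊗ₜ[ℝ] w ∈
      ⨆ k : ℕ, Module.End.eigenspace (superEuler m n) (k : ℝ) := by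
    intro w
    induction w using CliffordAlgebra.left_induction with
    | algebraMap r =>
      rw [Algebra.algebraMap_eq_smul_one, TensorProduct.tmul_smul]
      exact Submodule.smul_mem _ _ h1
    | add x y hx hy =>
      rw [TensorProduct.tmul_add]
      exact Submodule.add_mem _ hx hy
    | ι_mul w v hw =>
      have hv : (CliffordAlgebra.ι (0 : QuadraticForm ℝ (Fin (2 * n) → ℝ)) v) * w
          = ∑ j, v j • ((gGen j : GrassAlg (2 * n)) * w) := by
        conv_lhs => rw [pi_eq_sum_univ' v]
        rw [map_sum, Finset.sum_mul]
        refine Finset.sum_congr rfl fun j _ => ?_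
        rw [map_smul, smul_mul_assoc]
        congr 2
      rw [hv, TensorProduct.tmul_sum]
      refine Submodule.sum_mem _ fun j _ => ?_
      rw [TensorProduct.tmul_smul]
      exact Submodule.smul_mem _ _ (iSup_raise _ _ ((superWeyl_SP m n).E_f _ rfl j) _ hw)
  rintro z -
  induction z using TensorProduct.induction_on with
  | zero => exact Submodule.zero_mem _
  | add x y hx hy => exact Submodule.add_mem _ hx hy
  | tmul p w =>
    induction p using MvPolynomial.induction_on with
    | C a =>
      rw [← mul_one (C a), ← MvPolynomial.smul_eq_C_mul, ← TensorProduct.smul_tmul']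
      exact Submodule.smul_mem _ _ (h2 w)
    | add p q hp hq =>
      rw [TensorProduct.add_tmul]
      exact Submodule.add_mem _ hp hq
    | mul_X p i hp =>
      rw [mul_comm p (X i)]
      exact iSup_raise _ _ ((superWeyl_SP m n).E_b _ rfl i) _ hp

/-- the Fischer decomposition `P = ⊕_{j,k} R^{2j} H_k` when `M ∉ -2ℕ`. -/
theorem fischer_decomposition (m n : ℕ)
    (hM : ∀ j : ℕ, (m : ℤ) - 2 * n ≠ -2 * j) :
    DirectSum.IsInternal
      (fun p : ℕ × ℕ => Submodule.map ((mulRSq m n) ^ p.1) (Harm m n p.2)) := by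
  refine abs_fischer (superEuler m n) (mulRSq m n) (superLap m n) ((m : ℝ) - 2 * n)
    ?_ ?_ ?_ (iSup_Pdeg m n) ?_
  · intro v
    exact LinearMap.congr_fun ((superWeyl_SP m n).L_R (superEuler m n) (superLap m n)
      (mulRSq m n) rfl rfl (mulRSq_eq m n)) v
  · intro v
    exact LinearMap.congr_fun ((superWeyl_SP m n).E_R (superEuler m n)
      (mulRSq m n) rfl (mulRSq_eq m n)) v
  · intro v
    exact LinearMap.congr_fun ((superWeyl_SP m n).E_L (superEuler m n) (superLap m n) rfl rfl) v
  · intro j hj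
    exact hM j (by exact_mod_cast hj)

end
end

section
/- The Laplace–Beltrami operator Δ_LB := R²∇² − 𝔼(M − 2 + 𝔼) commutes with each of the operators L_{ij} = X_i ∂_{X^j} − (−1)^{[i][j]} X_j ∂_{X^i} generating osp(m|2n) on super polynomials. -/
open scoped TensorProduct
open MvPolynomial
set_option synthInstance.maxHeartbeats 1000000
set_option maxHeartbeats 1000000

noncomputable section

variable (m n : ℕ)

/-! ### Basic relations -/

section Helpers

variable {m n}

theorem hp_bder_bvar (i k : Fin m) :
    bder m n i * bvar m n k = bvar m n k * bder m n i + (if i = k then 1 else 0) := by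
  apply TensorProduct.ext'
  intro p q
  by_cases h : i = k
  · subst h
    simp [bder, bvar, TensorProduct.add_tmul, add_comm]
  · simp [bder, bvar, h, pderiv_X_of_ne (Ne.symm h)]

theorem hp_bder_bder (i k : Fin m) :
    bder m n i * bder m n k = bder m n k * bder m n i := by
  apply TensorProduct.ext'
  intro p q
  have h : pderiv i (pderiv k p) = pderiv k (pderiv i p) := by
    have h2 : ⁅(pderiv i : Derivation ℝ (MvPolynomial (Fin m) ℝ) (MvPolynomial (Fin m) ℝ)),
        (pderiv k : Derivation ℝ (MvPolynomial (Fin m) ℝ) (MvPolynomial (Fin m) ℝ))⁆ = 0 := by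
      apply MvPolynomial.derivation_ext
      intro j
      simp [Derivation.commutator_apply, pderiv_X, Pi.single_apply, apply_ite]
    have h3 := congrArg (fun D => D p) h2
    simpa [Derivation.commutator_apply, sub_eq_zero] using h3
  simp [bder, h]

theorem hp_bvar_bvar (i k : Fin m) :
    bvar m n i * bvar m n k = bvar m n k * bvar m n i := by
  apply TensorProduct.ext'
  intro p q
  simp [bvar, mul_left_comm]

theorem hp_b_f (u : Module.End ℝ (MvPolynomial (Fin m) ℝ)) (v : Module.End ℝ (GrassAlg (2 * n))) :
    (LinearMap.rTensor _ u * LinearMap.lTensor _ v : Module.End ℝ (SP m n)) =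
      LinearMap.lTensor _ v * LinearMap.rTensor _ u := by
  apply TensorProduct.ext'
  intro p q
  simp

theorem hp_bder_fder (i : Fin m) (j : Fin (2 * n)) :
    bder m n i * fderSP m n j = fderSP m n j * bder m n i := hp_b_f _ _

theorem hp_bder_fvar (i : Fin m) (j : Fin (2 * n)) :
    bder m n i * fvar m n j = fvar m n j * bder m n i := hp_b_f _ _

theorem hp_bvar_fder (i : Fin m) (j : Fin (2 * n)) :
    bvar m n i * fderSP m n j = fderSP m n j * bvar m n i := hp_b_f _ _

theorem hp_bvar_fvar (i : Fin m) (j : Fin (2 * n)) :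
    bvar m n i * fvar m n j = fvar m n j * bvar m n i := hp_b_f _ _

theorem hp_fder_fvar (j k : Fin (2 * n)) :
    fderSP m n j * fvar m n k = (if j = k then 1 else 0) - fvar m n k * fderSP m n j := by
  apply TensorProduct.ext'
  intro p q
  have h : gDer j (gGen k * q) = (if j = k then (1 : ℝ) else 0) • q - gGen k * gDer j q := by
    unfold gDer gGen
    refine (CliffordAlgebra.contractLeft_ι_mul _ _ _).trans ?_
    simp [Pi.single_apply]
  by_cases hjk : j = k
  · subst hjk
    rw [if_pos rfl, one_smul] at h
    simp [fderSP, fvar, h, TensorProduct.tmul_sub]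
  · simp [fderSP, fvar, h, hjk, TensorProduct.tmul_neg]

theorem hp_fder_fder (j k : Fin (2 * n)) :
    fderSP m n j * fderSP m n k = - (fderSP m n k * fderSP m n j) := by
  apply TensorProduct.ext'
  intro p q
  have h : gDer j (gDer k q) = - gDer k (gDer j q) := CliffordAlgebra.contractLeft_comm _ _ _
  simp [fderSP, h, TensorProduct.tmul_neg]

theorem hp_fvar_fvar (j k : Fin (2 * n)) :
    fvar m n j * fvar m n k = - (fvar m n k * fvar m n j) := by
  apply TensorProduct.ext'
  intro p q
  have h : gGen j * gGen k = - (gGen k * gGen j) :=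
    eq_neg_of_add_eq_zero_left (ExteriorAlgebra.ι_add_mul_swap _ _)
  simp [fvar, ← mul_assoc, h, TensorProduct.tmul_neg]

theorem hp_mulRSq : mulRSq m n = ∑ i : Fin m, bvar m n i * bvar m n i
    - ∑ j : Fin n, fvar m n (fi1 j) * fvar m n (fi2 j) := by
  apply TensorProduct.ext'
  intro p q
  simp [mulRSq, rSq, thetaSq, bvar, fvar, LinearMap.sum_apply, add_mul, Finset.sum_mul,
    TensorProduct.sum_tmul, TensorProduct.tmul_sum, mul_assoc, TensorProduct.tmul_neg,
    sub_eq_add_neg]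
  refine (neg_mul (α := SP m n) _ _).trans ?_
  rw [Finset.sum_mul]
  simp [mul_assoc]

/-! ### Index cases -/

theorem hp_cases {P : Fin (m + 2 * n) → Prop} (hb : ∀ k : Fin m, P (Fin.castAdd _ k))
    (h1 : ∀ k : Fin n, P (Fin.natAdd m (fi1 k))) (h2 : ∀ k : Fin n, P (Fin.natAdd m (fi2 k)))
    (i : Fin (m + 2 * n)) : P i := by
  refine Fin.addCases hb (fun k => ?_) i
  rcases Nat.even_or_odd' k.1 with ⟨c, hc | hc⟩
  · have : k = fi1 ⟨c, by have := k.2; omega⟩ := Fin.ext hc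
    rw [this]; exact h1 _
  · have : k = fi2 ⟨c, by have := k.2; omega⟩ := Fin.ext hc
    rw [this]; exact h2 _

theorem hp_svar_b (k : Fin m) : svar m n (Fin.castAdd _ k) = bvar m n k := by
  simp [svar]

theorem hp_svar_f (k : Fin (2 * n)) : svar m n (Fin.natAdd m k) = fvar m n k := by
  simp [svar]

theorem hp_sder_b (k : Fin m) : sder m n (Fin.castAdd _ k) = bder m n k := by
  simp [sder]

theorem hp_sder_f (k : Fin (2 * n)) : sder m n (Fin.natAdd m k) = fderSP m n k := by
  simp [sder]

theorem hp_up_b (k : Fin m) : sderUp m n (Fin.castAdd _ k) = bder m n k := by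
  unfold sderUp
  rw [Finset.sum_eq_single (Fin.castAdd _ k), hp_sder_b]
  · simp [gDown]
  · intro b _ hb
    have : gDown m n (Fin.castAdd _ k) b = 0 := by
      have hk := k.2
      have hb' : k.1 ≠ b.1 := fun h => hb (Fin.ext h.symm)
      simp only [gDown, Fin.ext_iff, Fin.val_castAdd]
      split_ifs <;> first | rfl | omega
    rw [this, zero_smul]
  · simp

theorem hp_val1 (k : Fin n) : (Fin.natAdd m (fi1 k)).1 = m + 2 * k.1 := rfl
theorem hp_val2 (k : Fin n) : (Fin.natAdd m (fi2 k)).1 = m + (2 * k.1 + 1) := rfl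

theorem hp_up_1 (k : Fin n) :
    sderUp m n (Fin.natAdd m (fi1 k)) = (2 : ℝ) • fderSP m n (fi2 k) := by
  unfold sderUp
  rw [Finset.sum_eq_single (Fin.natAdd m (fi2 k)), hp_sder_f]
  · congr 1
    rw [gDown, if_neg (by simp only [hp_val1, hp_val2]; omega),
      if_pos (by simp only [hp_val1, hp_val2]; omega)]
  · intro b _ hb
    have : gDown m n (Fin.natAdd m (fi1 k)) b = 0 := by
      have hb' : m + (2 * k.1 + 1) ≠ b.1 := fun h => hb (Fin.ext h.symm)
      rw [gDown, if_neg (by simp only [hp_val1, hp_val2]; omega),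
        if_neg (by simp only [hp_val1, hp_val2]; omega),
        if_neg (by simp only [hp_val1, hp_val2]; omega)]
    rw [this, zero_smul]
  · simp

theorem hp_up_2 (k : Fin n) :
    sderUp m n (Fin.natAdd m (fi2 k)) = (-2 : ℝ) • fderSP m n (fi1 k) := by
  unfold sderUp
  rw [Finset.sum_eq_single (Fin.natAdd m (fi1 k)), hp_sder_f]
  · congr 1
    rw [gDown, if_neg (by simp only [hp_val1, hp_val2]; omega),
      if_neg (by simp only [hp_val1, hp_val2]; omega),
      if_pos (by simp only [hp_val1, hp_val2]; omega)]
  · intro b _ hb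
    have : gDown m n (Fin.natAdd m (fi2 k)) b = 0 := by
      have hb' : m + (2 * k.1) ≠ b.1 := fun h => hb (Fin.ext h.symm)
      rw [gDown, if_neg (by simp only [hp_val1, hp_val2]; omega),
        if_neg (by simp only [hp_val1, hp_val2]; omega),
        if_neg (by simp only [hp_val1, hp_val2]; omega)]
    rw [this, zero_smul]
  · simp

theorem hp_par_b (k : Fin m) : par m n (Fin.castAdd _ k) = 0 := by simp [par]
theorem hp_par_f (k : Fin (2 * n)) : par m n (Fin.natAdd m k) = 1 := by simp [par]

theorem hp_fi11 (j k : Fin n) : fi1 j = fi1 k ↔ j = k := by simp [fi1, Fin.ext_iff]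
theorem hp_fi22 (j k : Fin n) : fi2 j = fi2 k ↔ j = k := by simp [fi2, Fin.ext_iff]
theorem hp_fi12 (j k : Fin n) : fi1 j ≠ fi2 k := by simp only [fi1, fi2, Ne, Fin.ext_iff]; omega
theorem hp_fi21 (j k : Fin n) : fi2 j ≠ fi1 k := by simp only [fi1, fi2, Ne, Fin.ext_iff]; omega

/-! ### Abstract commutators -/

theorem hp_lie_mul {A : Type*} [Ring A] (a b c : A) : ⁅a * b, c⁆ = a * ⁅b, c⁆ + ⁅a, c⁆ * b := by
  simp only [Ring.lie_def]; noncomm_ring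

theorem hp_lie_mul' {A : Type*} [Ring A] (a b c : A) :
    ⁅a * b, c⁆ = a * (b * c + c * b) - (a * c + c * a) * b := by
  simp only [Ring.lie_def]; noncomm_ring

theorem hp_lie_mul_r {A : Type*} [Ring A] (a b c : A) : ⁅c, a * b⁆ = a * ⁅c, b⁆ + ⁅c, a⁆ * b := by
  simp only [Ring.lie_def]; noncomm_ring

theorem hp_lie_mul_r' {A : Type*} [Ring A] (a b c : A) :
    ⁅c, a * b⁆ = (c * a + a * c) * b - a * (c * b + b * c) := by
  simp only [Ring.lie_def]; noncomm_ring


set_option linter.unusedSectionVars false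

variable {A : Type*} [Ring A] [Algebra ℝ A]

theorem hq_sub_lie (x y z : A) : ⁅x - y, z⁆ = ⁅x, z⁆ - ⁅y, z⁆ := by
  simp only [Ring.lie_def]; noncomm_ring
theorem hq_add_lie (x y z : A) : ⁅x + y, z⁆ = ⁅x, z⁆ + ⁅y, z⁆ := by
  simp only [Ring.lie_def]; noncomm_ring
theorem hq_lie_sub (x y z : A) : ⁅x, y - z⁆ = ⁅x, y⁆ - ⁅x, z⁆ := by
  simp only [Ring.lie_def]; noncomm_ring
theorem hq_lie_skew (x y : A) : - ⁅y, x⁆ = ⁅x, y⁆ := by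
  simp only [Ring.lie_def]; noncomm_ring
theorem hq_smul_lie (c : ℝ) (x y : A) : ⁅c • x, y⁆ = c • ⁅x, y⁆ := by
  simp only [Ring.lie_def, smul_mul_assoc, mul_smul_comm, smul_sub]
theorem hq_lie_smul (c : ℝ) (x y : A) : ⁅x, c • y⁆ = c • ⁅x, y⁆ := by
  simp only [Ring.lie_def, smul_mul_assoc, mul_smul_comm, smul_sub]
theorem hq_sum_lie {ι : Type*} (S : Finset ι) (x : ι → A) (y : A) :
    ⁅∑ i ∈ S, x i, y⁆ = ∑ i ∈ S, ⁅x i, y⁆ := by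
  simp only [Ring.lie_def, Finset.sum_mul, Finset.mul_sum, Finset.sum_sub_distrib]

/-- The abstract relations between the coordinate and derivative operators. -/
structure HRel (b d : Fin m → A) (f g : Fin (2 * n) → A) (s t u : Fin (m + 2 * n) → A) :
    Prop where
  bder_bvar : ∀ i k, d i * b k = b k * d i + (if i = k then 1 else 0)
  bder_bder : ∀ i k, d i * d k = d k * d i
  bvar_bvar : ∀ i k, b i * b k = b k * b i
  bder_fder : ∀ i k, d i * g k = g k * d i
  bder_fvar : ∀ i k, d i * f k = f k * d i
  bvar_fder : ∀ i k, b i * g k = g k * b i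
  bvar_fvar : ∀ i k, b i * f k = f k * b i
  fder_fvar : ∀ j k, g j * f k = (if j = k then 1 else 0) - f k * g j
  fder_fder : ∀ j k, g j * g k = - (g k * g j)
  fvar_fvar : ∀ j k, f j * f k = - (f k * f j)
  svar_b : ∀ k, s (Fin.castAdd _ k) = b k
  svar_f : ∀ k, s (Fin.natAdd m k) = f k
  sder_b : ∀ k, t (Fin.castAdd _ k) = d k
  sder_f : ∀ k, t (Fin.natAdd m k) = g k
  up_b : ∀ k, u (Fin.castAdd _ k) = d k
  up_1 : ∀ k, u (Fin.natAdd m (fi1 k)) = (2 : ℝ) • g (fi2 k)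
  up_2 : ∀ k, u (Fin.natAdd m (fi2 k)) = (-2 : ℝ) • g (fi1 k)

/-- Abstract super Laplacian. -/
def hLap (d : Fin m → A) (g : Fin (2 * n) → A) : A :=
  ∑ i : Fin m, d i * d i - (4 : ℝ) • ∑ j : Fin n, g (fi1 j) * g (fi2 j)

/-- Abstract norm squared. -/
def hR (b : Fin m → A) (f : Fin (2 * n) → A) : A :=
  ∑ i : Fin m, b i * b i - ∑ j : Fin n, f (fi1 j) * f (fi2 j)

/-- Abstract Euler operator. -/
def hE (b d : Fin m → A) (f g : Fin (2 * n) → A) : A :=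
  ∑ i : Fin m, b i * d i + ∑ j : Fin (2 * n), f j * g j

/-- Abstract generators. -/
def hLg (s u : Fin (m + 2 * n) → A) (i j : Fin (m + 2 * n)) : A :=
  s i * u j - ((-1 : ℝ) ^ (par m n i * par m n j)) • (s j * u i)

variable {b d : Fin m → A} {f g : Fin (2 * n) → A} {s t u : Fin (m + 2 * n) → A}

theorem HRel.hl_bder_bvar (H : HRel b d f g s t u) (i k : Fin m) : ⁅d i, b k⁆ = if i = k then 1 else 0 := by
  rw [Ring.lie_def, H.bder_bvar]; abel
theorem HRel.hl_bvar_bder (H : HRel b d f g s t u) (i k : Fin m) : ⁅b i, d k⁆ = if i = k then -1 else 0 := by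
  rw [← hq_lie_skew, H.hl_bder_bvar]; by_cases h : i = k <;> simp [h, Ne.symm, eq_comm]
theorem HRel.hl_bder_bder (H : HRel b d f g s t u) (i k : Fin m) : ⁅d i, d k⁆ = 0 :=
  sub_eq_zero.2 (H.bder_bder i k)
theorem HRel.hl_bvar_bvar (H : HRel b d f g s t u) (i k : Fin m) : ⁅b i, b k⁆ = 0 :=
  sub_eq_zero.2 (H.bvar_bvar i k)
theorem HRel.hl_bder_fder (H : HRel b d f g s t u) (i : Fin m) (k) : ⁅d i, g k⁆ = 0 :=
  sub_eq_zero.2 (H.bder_fder i k)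
theorem HRel.hl_bder_fvar (H : HRel b d f g s t u) (i : Fin m) (k) : ⁅d i, f k⁆ = 0 :=
  sub_eq_zero.2 (H.bder_fvar i k)
theorem HRel.hl_bvar_fder (H : HRel b d f g s t u) (i : Fin m) (k) : ⁅b i, g k⁆ = 0 :=
  sub_eq_zero.2 (H.bvar_fder i k)
theorem HRel.hl_bvar_fvar (H : HRel b d f g s t u) (i : Fin m) (k) : ⁅b i, f k⁆ = 0 :=
  sub_eq_zero.2 (H.bvar_fvar i k)
theorem HRel.hl_fder_bder (H : HRel b d f g s t u) (i : Fin m) (k) : ⁅g k, d i⁆ = 0 :=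
  sub_eq_zero.2 (H.bder_fder i k).symm
theorem HRel.hl_fvar_bder (H : HRel b d f g s t u) (i : Fin m) (k) : ⁅f k, d i⁆ = 0 :=
  sub_eq_zero.2 (H.bder_fvar i k).symm
theorem HRel.hl_fder_bvar (H : HRel b d f g s t u) (i : Fin m) (k) : ⁅g k, b i⁆ = 0 :=
  sub_eq_zero.2 (H.bvar_fder i k).symm
theorem HRel.hl_fvar_bvar (H : HRel b d f g s t u) (i : Fin m) (k) : ⁅f k, b i⁆ = 0 :=
  sub_eq_zero.2 (H.bvar_fvar i k).symm

theorem HRel.ha_fder_fvar (H : HRel b d f g s t u) (j k : Fin (2 * n)) :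
    g j * f k + f k * g j = if j = k then 1 else 0 := by
  rw [H.fder_fvar]; abel
theorem HRel.ha_fvar_fder (H : HRel b d f g s t u) (j k : Fin (2 * n)) :
    f j * g k + g k * f j = if j = k then 1 else 0 := by
  rw [add_comm, H.ha_fder_fvar]; simp [eq_comm]
theorem HRel.ha_fder_fder (H : HRel b d f g s t u) (j k : Fin (2 * n)) :
    g j * g k + g k * g j = 0 := by
  rw [H.fder_fder]; abel
theorem HRel.ha_fvar_fvar (H : HRel b d f g s t u) (j k : Fin (2 * n)) :
    f j * f k + f k * f j = 0 := by
  rw [H.fvar_fvar]; abel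

/-! ### Commutators with the `sl₂` operators -/

theorem HRel.hc_lap_svar (H : HRel b d f g s t u) (i : Fin (m + 2 * n)) :
    ⁅hLap d g, s i⁆ = (2 : ℝ) • u i := by
  induction i using hp_cases with
  | hb k =>
    rw [H.svar_b, H.up_b, hLap, hq_sub_lie, hq_smul_lie, hq_sum_lie, hq_sum_lie]
    simp [hp_lie_mul, H.hl_bder_bvar, H.hl_fder_bvar, Finset.sum_add_distrib, two_smul]
  | h1 k =>
    rw [H.svar_f, H.up_1, hLap, hq_sub_lie, hq_smul_lie, hq_sum_lie, hq_sum_lie]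
    simp only [hp_lie_mul (d _), hp_lie_mul' (g _), H.hl_bder_fvar, H.ha_fder_fvar,
      hp_fi11, hp_fi21]
    simp [smul_smul]
    norm_num
  | h2 k =>
    rw [H.svar_f, H.up_2, hLap, hq_sub_lie, hq_smul_lie, hq_sum_lie, hq_sum_lie]
    simp only [hp_lie_mul (d _), hp_lie_mul' (g _), H.hl_bder_fvar, H.ha_fder_fvar,
      hp_fi22, hp_fi12]
    simp [smul_smul]
    norm_num

theorem HRel.hc_lap_up (H : HRel b d f g s t u) (i : Fin (m + 2 * n)) : ⁅hLap d g, u i⁆ = 0 := by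
  have hb (k : Fin m) : ⁅hLap d g, d k⁆ = 0 := by
    rw [hLap, hq_sub_lie, hq_smul_lie, hq_sum_lie, hq_sum_lie]
    simp [hp_lie_mul, H.hl_bder_bder, H.hl_fder_bder]
  have hf (k : Fin (2 * n)) : ⁅hLap d g, g k⁆ = 0 := by
    rw [hLap, hq_sub_lie, hq_smul_lie, hq_sum_lie, hq_sum_lie]
    simp only [hp_lie_mul (d _), hp_lie_mul' (g _), H.hl_bder_fder, H.ha_fder_fder]
    simp
  induction i using hp_cases with
  | hb k => rw [H.up_b, hb]
  | h1 k => rw [H.up_1, hq_lie_smul, hf, smul_zero]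
  | h2 k => rw [H.up_2, hq_lie_smul, hf, smul_zero]

theorem HRel.hc_R_svar (H : HRel b d f g s t u) (i : Fin (m + 2 * n)) : ⁅hR b f, s i⁆ = 0 := by
  have hb (k : Fin m) : ⁅hR b f, b k⁆ = 0 := by
    rw [hR, hq_sub_lie, hq_sum_lie, hq_sum_lie]
    simp [hp_lie_mul, H.hl_bvar_bvar, H.hl_fvar_bvar]
  have hf (k : Fin (2 * n)) : ⁅hR b f, f k⁆ = 0 := by
    rw [hR, hq_sub_lie, hq_sum_lie, hq_sum_lie]
    simp only [hp_lie_mul (b _), hp_lie_mul' (f _), H.hl_bvar_fvar, H.ha_fvar_fvar]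
    simp
  induction i using hp_cases with
  | hb k => rw [H.svar_b, hb]
  | h1 k => rw [H.svar_f, hf]
  | h2 k => rw [H.svar_f, hf]

theorem HRel.hc_R_up (H : HRel b d f g s t u) (i : Fin (m + 2 * n)) :
    ⁅hR b f, u i⁆ = (-2 : ℝ) • s i := by
  induction i using hp_cases with
  | hb k =>
    rw [H.svar_b, H.up_b, hR, hq_sub_lie, hq_sum_lie, hq_sum_lie]
    simp [hp_lie_mul, H.hl_bvar_bder, H.hl_fvar_bder, Finset.sum_add_distrib, two_smul]
  | h1 k =>
    rw [H.svar_f, H.up_1, hR, hq_lie_smul, hq_sub_lie, hq_sum_lie, hq_sum_lie]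
    simp only [hp_lie_mul (b _), hp_lie_mul' (f _), H.hl_bvar_fder, H.ha_fvar_fder,
      hp_fi22, hp_fi12]
    simp
  | h2 k =>
    rw [H.svar_f, H.up_2, hR, hq_lie_smul, hq_sub_lie, hq_sum_lie, hq_sum_lie]
    simp only [hp_lie_mul (b _), hp_lie_mul' (f _), H.hl_bvar_fder, H.ha_fvar_fder,
      hp_fi11, hp_fi21]
    simp

theorem HRel.hc_E_svar (H : HRel b d f g s t u) (i : Fin (m + 2 * n)) : ⁅hE b d f g, s i⁆ = s i := by
  have hb (k : Fin m) : ⁅hE b d f g, b k⁆ = b k := by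
    rw [hE, hq_add_lie, hq_sum_lie, hq_sum_lie]
    simp [hp_lie_mul, H.hl_bvar_bvar, H.hl_fvar_bvar, H.hl_bder_bvar, H.hl_fder_bvar]
  have hf (k : Fin (2 * n)) : ⁅hE b d f g, f k⁆ = f k := by
    rw [hE, hq_add_lie, hq_sum_lie, hq_sum_lie]
    simp only [hp_lie_mul (b _), hp_lie_mul' (f _), H.hl_bvar_fvar, H.ha_fvar_fvar,
      H.hl_bder_fvar, H.ha_fder_fvar]
    simp
  induction i using hp_cases with
  | hb k => rw [H.svar_b, hb]
  | h1 k => rw [H.svar_f, hf]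
  | h2 k => rw [H.svar_f, hf]

theorem HRel.hc_E_up (H : HRel b d f g s t u) (i : Fin (m + 2 * n)) : ⁅hE b d f g, u i⁆ = - u i := by
  have hb (k : Fin m) : ⁅hE b d f g, d k⁆ = - d k := by
    rw [hE, hq_add_lie, hq_sum_lie, hq_sum_lie]
    simp [hp_lie_mul, H.hl_bvar_bder, H.hl_fvar_bder, H.hl_bder_bder, H.hl_fder_bder]
  have hf (k : Fin (2 * n)) : ⁅hE b d f g, g k⁆ = - g k := by
    rw [hE, hq_add_lie, hq_sum_lie, hq_sum_lie]
    simp only [hp_lie_mul (b _), hp_lie_mul' (f _), H.hl_bvar_fder, H.ha_fvar_fder,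
      H.hl_bder_fder, H.ha_fder_fder]
    simp
  induction i using hp_cases with
  | hb k => rw [H.up_b, hb]
  | h1 k => rw [H.up_1, hq_lie_smul, hf, smul_neg]
  | h2 k => rw [H.up_2, hq_lie_smul, hf, smul_neg]

/-! ### Super commutativity -/

theorem HRel.hs_svar (H : HRel b d f g s t u) (i j : Fin (m + 2 * n)) : s i * s j =
    ((-1 : ℝ) ^ (par m n i * par m n j)) • (s j * s i) := by
  induction i using Fin.addCases with
  | left i =>
    induction j using Fin.addCases with
    | left j => simp [H.svar_b, hp_par_b, H.bvar_bvar i j]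
    | right j => simp [H.svar_b, H.svar_f, hp_par_b, H.bvar_fvar i j]
  | right i =>
    induction j using Fin.addCases with
    | left j => simp [H.svar_b, H.svar_f, hp_par_b, H.bvar_fvar j i]
    | right j => simp [H.svar_f, hp_par_f, H.fvar_fvar i j]

theorem HRel.hs_sder (H : HRel b d f g s t u) (i j : Fin (m + 2 * n)) : t i * t j =
    ((-1 : ℝ) ^ (par m n i * par m n j)) • (t j * t i) := by
  induction i using Fin.addCases with
  | left i =>
    induction j using Fin.addCases with
    | left j => simp [H.sder_b, hp_par_b, H.bder_bder i j]
    | right j => simp [H.sder_b, H.sder_f, hp_par_b, H.bder_fder i j]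
  | right i =>
    induction j using Fin.addCases with
    | left j => simp [H.sder_b, H.sder_f, hp_par_b, H.bder_fder j i]
    | right j => simp [H.sder_f, hp_par_f, H.fder_fder i j]

theorem HRel.hs_up (H : HRel b d f g s t u) (i j : Fin (m + 2 * n)) : u i * u j =
    ((-1 : ℝ) ^ (par m n i * par m n j)) • (u j * u i) := by
  have key (i : Fin (m + 2 * n)) : ∃ (c : ℝ) (k : Fin (m + 2 * n)),
      par m n k = par m n i ∧ u i = c • t k := by
    induction i using hp_cases with
    | hb k => exact ⟨1, Fin.castAdd _ k, rfl, by rw [H.up_b, H.sder_b, one_smul]⟩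
    | h1 k => exact ⟨2, Fin.natAdd m (fi2 k), by simp [hp_par_f], by rw [H.up_1, H.sder_f]⟩
    | h2 k => exact ⟨-2, Fin.natAdd m (fi1 k), by simp [hp_par_f], by rw [H.up_2, H.sder_f]⟩
  obtain ⟨c, k, hk, hk'⟩ := key i
  obtain ⟨d, l, hl, hl'⟩ := key j
  rw [hk', hl', ← hk, ← hl, smul_mul_smul_comm, smul_mul_smul_comm, H.hs_sder k l, smul_comm,
    mul_comm c d]

/-! ### Commutators with `L_{ij}` -/

theorem HRel.hL_lap (H : HRel b d f g s t u) (i j : Fin (m + 2 * n)) : ⁅hLap d g, hLg (m := m) (n := n) s u i j⁆ = 0 := by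
  rw [hLg, hq_lie_sub, hq_lie_smul, hp_lie_mul_r, hp_lie_mul_r, H.hc_lap_svar, H.hc_lap_svar, H.hc_lap_up,
    H.hc_lap_up, mul_zero, mul_zero, zero_add, zero_add, smul_mul_assoc, smul_mul_assoc, H.hs_up i j,
    smul_comm, sub_self]

theorem HRel.hL_R (H : HRel b d f g s t u) (i j : Fin (m + 2 * n)) : ⁅hR b f, hLg (m := m) (n := n) s u i j⁆ = 0 := by
  rw [hLg, hq_lie_sub, hq_lie_smul, hp_lie_mul_r, hp_lie_mul_r, H.hc_R_svar, H.hc_R_svar, H.hc_R_up,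
    H.hc_R_up, zero_mul, zero_mul, add_zero, add_zero, mul_smul_comm, mul_smul_comm, H.hs_svar i j,
    smul_comm, sub_self]

theorem HRel.hL_E (H : HRel b d f g s t u) (i j : Fin (m + 2 * n)) : ⁅hE b d f g, hLg (m := m) (n := n) s u i j⁆ = 0 := by
  rw [hLg, hq_lie_sub, hq_lie_smul, hp_lie_mul_r, hp_lie_mul_r, H.hc_E_svar, H.hc_E_svar, H.hc_E_up,
    H.hc_E_up]
  simp

theorem HRel.main (H : HRel b d f g s t u) (i j : Fin (m + 2 * n)) (c : ℝ) :
    (hR b f * hLap d g - hE b d f g * (c • (1 : A) + hE b d f g)) * hLg (m := m) (n := n) s u i j =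
    hLg (m := m) (n := n) s u i j *
      (hR b f * hLap d g - hE b d f g * (c • (1 : A) + hE b d f g)) := by
  have h1 : Commute (hLap d g) (hLg (m := m) (n := n) s u i j) := sub_eq_zero.1 (H.hL_lap i j)
  have h2 : Commute (hR b f) (hLg (m := m) (n := n) s u i j) := sub_eq_zero.1 (H.hL_R i j)
  have h3 : Commute (hE b d f g) (hLg (m := m) (n := n) s u i j) := sub_eq_zero.1 (H.hL_E i j)
  exact (h2.mul_left h1).sub_left
    (h3.mul_left (((Commute.one_left _).smul_left _).add_left h3))

theorem hp_rel : HRel (bvar m n) (bder m n) (fvar m n) (fderSP m n) (svar m n) (sder m n)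
    (sderUp m n) where
  bder_bvar := hp_bder_bvar
  bder_bder := hp_bder_bder
  bvar_bvar := hp_bvar_bvar
  bder_fder := hp_bder_fder
  bder_fvar := hp_bder_fvar
  bvar_fder := hp_bvar_fder
  bvar_fvar := hp_bvar_fvar
  fder_fvar := hp_fder_fvar
  fder_fder := hp_fder_fder
  fvar_fvar := hp_fvar_fvar
  svar_b := hp_svar_b
  svar_f := hp_svar_f
  sder_b := hp_sder_b
  sder_f := hp_sder_f
  up_b := hp_up_b
  up_1 := hp_up_1
  up_2 := hp_up_2

end Helpers

/-- the Laplace–Beltrami operator commutes with all `osp(m|2n)`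
generators `L_{ij}`. -/
theorem lapBeltrami_commutes_Lgen (m n : ℕ) (i j : Fin (m + 2 * n)) :
    lapBeltrami m n * Lgen m n i j = Lgen m n i j * lapBeltrami m n := by
  have h := (hp_rel (m := m) (n := n)).main i j (((m : ℝ) - 2 * n) - 2)
  unfold lapBeltrami
  rw [hp_mulRSq]
  exact h

end
end

section
/- The Pizzetti integral vanishes on products of spherical harmonics of distinct degrees: if H_k ∈ H_k and H_l ∈ H_l with k ≠ l, then Σ_{j≥0} (2π^{M/2}/(2^{2j} j! Γ(j+M/2))) (∇^{2j}(H_k H_l))(0) = 0. -/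
open scoped TensorProduct
open MvPolynomial
set_option synthInstance.maxHeartbeats 1000000
set_option maxHeartbeats 1000000

noncomputable section

variable (m n : ℕ)

/-- The Pizzetti functional
`T(f) = Σ_k (2π^{M/2}/(2^{2k} k! Γ(k+M/2))) (∇^{2k}f)(0)`. -/
def pizzetti (m n : ℕ) (f : SP m n) : ℝ :=
  ∑' k : ℕ,
    (2 * Real.pi ^ (((m : ℝ) - 2 * n) / 2) /
        (2 ^ (2 * k) * (k.factorial : ℝ) *
          Real.Gamma ((k : ℝ) + ((m : ℝ) - 2 * n) / 2))) *
      scalarPart m n (((superLap m n) ^ k) f)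
/-! ### Grassmann algebra facts -/

theorem gHat_gDer {N : ℕ} (j : Fin N) (x : GrassAlg N) :
    CliffordAlgebra.involute (gDer j x) = - gDer j (CliffordAlgebra.involute x) := by
  unfold gDer
  induction x using CliffordAlgebra.left_induction with
  | algebraMap r => simp [CliffordAlgebra.contractLeft_algebraMap]
  | add x y hx hy => simp only [map_add, hx, hy, neg_add]
  | ι_mul x v hx =>
    simp only [CliffordAlgebra.contractLeft_ι_mul, map_sub, map_smul, map_mul, hx,
      CliffordAlgebra.involute_ι, neg_mul, map_neg]
    simp only [mul_neg, neg_neg]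

theorem gDer_mul {N : ℕ} (j : Fin N) (x y : GrassAlg N) :
    gDer j (x * y) = gDer j x * y + CliffordAlgebra.involute x * gDer j y := by
  unfold gDer
  induction x using CliffordAlgebra.left_induction with
  | algebraMap r =>
    simp [CliffordAlgebra.contractLeft_algebraMap, CliffordAlgebra.contractLeft_algebraMap_mul]
  | add x z hx hz => simp only [map_add, add_mul, hx, hz]; abel
  | ι_mul x v hx =>
    rw [mul_assoc]
    simp only [CliffordAlgebra.contractLeft_ι_mul, map_mul, hx,
      CliffordAlgebra.involute_ι, neg_mul, sub_mul, mul_add, mul_assoc, smul_mul_assoc]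
    abel

theorem gDer_comm {N : ℕ} (i j : Fin N) : gDer i * gDer j = -(gDer j * gDer i) := by
  exact LinearMap.ext fun x => CliffordAlgebra.contractLeft_comm
    (Q := (0 : QuadraticForm ℝ (Fin N → ℝ))) (LinearMap.proj i) (LinearMap.proj j) x

theorem gDer_gGen {N : ℕ} (i j : Fin N) :
    gDer i * LinearMap.mulLeft ℝ (gGen j)
      = (if i = j then (1 : ℝ) else 0) • (1 : Module.End ℝ (GrassAlg N))
        - LinearMap.mulLeft ℝ (gGen j) * gDer i := by
  refine LinearMap.ext fun x => ?_
  have := CliffordAlgebra.contractLeft_ι_mul (Q := (0 : QuadraticForm ℝ (Fin N → ℝ)))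
    (LinearMap.proj i) (Pi.single j 1) x
  rw [LinearMap.proj_apply, Pi.single_apply] at this
  exact this

/-! ### Operators on super polynomials -/

/-- The parity involution on super polynomials. -/
def hatSP : Module.End ℝ (SP m n) :=
  LinearMap.lTensor _ (CliffordAlgebra.involute
    (Q := (0 : QuadraticForm ℝ (Fin (2 * n) → ℝ)))).toLinearMap

variable {m n}

theorem rl_comm (f : Module.End ℝ (MvPolynomial (Fin m) ℝ))
    (g : Module.End ℝ (GrassAlg (2 * n))) :
    Commute (LinearMap.rTensor (GrassAlg (2 * n)) f : Module.End ℝ (SP m n))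
      (LinearMap.lTensor (MvPolynomial (Fin m) ℝ) g) := by
  unfold Commute SemiconjBy
  rw [Module.End.mul_eq_comp, Module.End.mul_eq_comp, LinearMap.rTensor_comp_lTensor,
    LinearMap.lTensor_comp_rTensor]

theorem bder_bder (i j : Fin m) : Commute (bder m n i) (bder m n j) := by
  unfold Commute SemiconjBy bder
  rw [← LinearMap.rTensor_mul, ← LinearMap.rTensor_mul]
  congr 1
  refine LinearMap.ext fun x => ?_
  have h : ⁅pderiv (R := ℝ) i, pderiv (R := ℝ) j⁆ = 0 := by
    apply MvPolynomial.derivation_ext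
    intro l
    rw [Derivation.commutator_apply, pderiv_X, pderiv_X]
    simp [Pi.single_apply, apply_ite]
  have h' := congrArg (fun D => D x) h
  simp only [Derivation.commutator_apply, Derivation.zero_apply] at h'
  exact sub_eq_zero.1 h'

theorem bder_fder (i : Fin m) (j : Fin (2 * n)) : Commute (bder m n i) (fderSP m n j) :=
  rl_comm _ _

theorem bder_fvar (i : Fin m) (j : Fin (2 * n)) : Commute (bder m n i) (fvar m n j) :=
  rl_comm _ _

theorem bvar_fder (i : Fin m) (j : Fin (2 * n)) : Commute (bvar m n i) (fderSP m n j) :=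
  rl_comm _ _

theorem bder_hat (i : Fin m) : Commute (bder m n i) (hatSP m n) := rl_comm _ _

theorem bvar_hat (i : Fin m) : Commute (bvar m n i) (hatSP m n) := rl_comm _ _

theorem fder_fder (i j : Fin (2 * n)) :
    fderSP m n i * fderSP m n j = -(fderSP m n j * fderSP m n i) := by
  unfold fderSP
  rw [← LinearMap.lTensor_mul, ← LinearMap.lTensor_mul, gDer_comm, LinearMap.lTensor_neg]

theorem hat_fder (j : Fin (2 * n)) :
    hatSP m n * fderSP m n j = -(fderSP m n j * hatSP m n) := by
  unfold fderSP hatSP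
  rw [← LinearMap.lTensor_mul, ← LinearMap.lTensor_mul, ← LinearMap.lTensor_neg]
  congr 1
  exact LinearMap.ext fun x => gHat_gDer j x

theorem hat_fvar (j : Fin (2 * n)) :
    hatSP m n * fvar m n j = -(fvar m n j * hatSP m n) := by
  unfold fvar hatSP
  rw [← LinearMap.lTensor_mul, ← LinearMap.lTensor_mul, ← LinearMap.lTensor_neg]
  congr 1
  refine LinearMap.ext fun x => ?_
  have : CliffordAlgebra.involute (gGen j : GrassAlg (2 * n)) = - gGen j :=
    CliffordAlgebra.involute_ι _
  simp [this]

theorem fder_fvar (i j : Fin (2 * n)) :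
    fderSP m n i * fvar m n j = (if i = j then (1 : ℝ) else 0) • (1 : Module.End ℝ (SP m n))
      - fvar m n j * fderSP m n i := by
  unfold fderSP fvar
  rw [← LinearMap.lTensor_mul, ← LinearMap.lTensor_mul, gDer_gGen, LinearMap.lTensor_sub,
    LinearMap.lTensor_smul]
  congr 2
  exact LinearMap.lTensor_id _ _

theorem bder_bvar (i j : Fin m) :
    bder m n i * bvar m n j = (if i = j then (1 : ℝ) else 0) • (1 : Module.End ℝ (SP m n))
      + bvar m n j * bder m n i := by
  unfold bder bvar
  have : (pderiv i).toLinearMap * LinearMap.mulLeft ℝ (X j : MvPolynomial (Fin m) ℝ)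
      = (if i = j then (1 : ℝ) else 0) • (1 : Module.End ℝ (MvPolynomial (Fin m) ℝ))
        + LinearMap.mulLeft ℝ (X j) * (pderiv i).toLinearMap := by
    refine LinearMap.ext fun x => ?_
    by_cases h : i = j
    · subst h; simp [add_comm]
    · simp [h, pderiv_X_of_ne (Ne.symm h)]
  rw [← LinearMap.rTensor_mul, ← LinearMap.rTensor_mul, this, LinearMap.rTensor_add,
    LinearMap.rTensor_smul]
  congr 2
  exact LinearMap.rTensor_id _ _

theorem bder_mul (i : Fin m) (f g : SP m n) :
    bder m n i (f * g) = bder m n i f * g + f * bder m n i g := by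
  unfold bder
  induction f using TensorProduct.induction_on with
  | zero => simp
  | add a b ha hb => simp only [add_mul, map_add, ha, hb]; abel
  | tmul p a =>
    induction g using TensorProduct.induction_on with
    | zero => simp
    | add c d hc hd => simp only [mul_add, map_add, hc, hd]; abel
    | tmul q b =>
      simp only [Algebra.TensorProduct.tmul_mul_tmul, LinearMap.rTensor_tmul,
        Derivation.coeFn_coe, Derivation.leibniz, smul_eq_mul, TensorProduct.add_tmul]
      rw [add_comm, mul_comm q]

theorem fder_mul (j : Fin (2 * n)) (f g : SP m n) :
    fderSP m n j (f * g) = fderSP m n j f * g + hatSP m n f * fderSP m n j g := by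
  unfold fderSP hatSP
  induction f using TensorProduct.induction_on with
  | zero => simp
  | add a b ha hb => simp only [add_mul, map_add, ha, hb]; abel
  | tmul p a =>
    induction g using TensorProduct.induction_on with
    | zero => simp
    | add c d hc hd => simp only [mul_add, map_add, hc, hd]; abel
    | tmul q b =>
      simp only [Algebra.TensorProduct.tmul_mul_tmul, LinearMap.lTensor_tmul,
        gDer_mul, TensorProduct.tmul_add, AlgHom.toLinearMap_apply]

theorem hat_hat (f : SP m n) : hatSP m n (hatSP m n f) = f := by
  unfold hatSP
  induction f using TensorProduct.induction_on with
  | zero => simp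
  | add a b ha hb => simp only [map_add, ha, hb]
  | tmul p a => simp

theorem fder_fder_mul (a b : Fin (2 * n)) (f g : SP m n) :
    fderSP m n a (fderSP m n b (f * g)) = fderSP m n a (fderSP m n b f) * g
      + hatSP m n (fderSP m n b f) * fderSP m n a g
      - hatSP m n (fderSP m n a f) * fderSP m n b g
      + f * fderSP m n a (fderSP m n b g) := by
  have h : fderSP m n a (hatSP m n f) = - hatSP m n (fderSP m n a f) := by
    have := LinearMap.congr_fun (hat_fder (m := m) a) f
    simp only [Module.End.mul_apply, LinearMap.neg_apply] at this
    rw [this, neg_neg]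
  rw [fder_mul, map_add, fder_mul, fder_mul, h, hat_hat]
  have h3 : -(hatSP m n) ((fderSP m n a) f) * (fderSP m n b) g
      = -((hatSP m n) ((fderSP m n a) f) * (fderSP m n b) g) :=
    neg_mul (α := SP m n) _ _
  rw [h3]
  abel

theorem superLap_mul (f g : SP m n) :
    superLap m n (f * g) = superLap m n f * g + f * superLap m n g
      + ((2 : ℝ) • ∑ i : Fin m, bder m n i f * bder m n i g
        - (4 : ℝ) • ∑ j : Fin n, (hatSP m n (fderSP m n (fi2 j) f) * fderSP m n (fi1 j) g
            - hatSP m n (fderSP m n (fi1 j) f) * fderSP m n (fi2 j) g)) := by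
  unfold superLap
  simp only [LinearMap.sub_apply, LinearMap.smul_apply, LinearMap.sum_apply,
    Module.End.mul_apply, fder_fder_mul, bder_mul, map_add, sub_mul, mul_sub,
    smul_mul_assoc, mul_smul_comm, Finset.sum_mul, Finset.mul_sum, Finset.sum_add_distrib,
    Finset.sum_sub_distrib]
  module

theorem superLap_bder (i : Fin m) : Commute (superLap m n) (bder m n i) := by
  unfold superLap
  refine Commute.sub_left (R := Module.End ℝ (SP m n)) (Commute.sum_left _ _ _ fun j _ => ?_)
    (Commute.smul_left (Commute.sum_left _ _ _ fun j _ => ?_) _)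
  · exact (bder_bder j i).mul_left (bder_bder j i)
  · exact (bder_fder i _).symm.mul_left (bder_fder i _).symm

theorem anti_comm_mul {A : Type*} [Ring A] {a b c : A} (ha : a * c = -(c * a))
    (hb : b * c = -(c * b)) : Commute (a * b) c := by
  unfold Commute SemiconjBy
  rw [mul_assoc, hb, mul_neg, ← mul_assoc, ha, neg_mul, neg_neg, mul_assoc]

theorem anti_aux {A : Type*} [Ring A] {a b c d e : A} (he : d * c = e)
    (h1 : a * b = d - b * a) (h2 : a * c = -(c * a)) :
    a * (b * c) = e + b * c * a := by
  rw [← mul_assoc, h1, sub_mul, mul_assoc, h2, he, mul_neg, ← mul_assoc, sub_neg_eq_add]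

theorem superLap_fder (j : Fin (2 * n)) : Commute (superLap m n) (fderSP m n j) := by
  unfold superLap
  refine Commute.sub_left (R := Module.End ℝ (SP m n)) (Commute.sum_left _ _ _ fun i _ => ?_)
    (Commute.smul_left (Commute.sum_left _ _ _ fun i _ => ?_) _)
  · exact (bder_fder i j).mul_left (bder_fder i j)
  · exact anti_comm_mul (A := Module.End ℝ (SP m n)) (fder_fder _ _) (fder_fder _ _)

theorem hat_fder_symm (j : Fin (2 * n)) :
    fderSP m n j * hatSP m n = -(hatSP m n * fderSP m n j) := by
  rw [hat_fder]
  exact (neg_neg (G := Module.End ℝ (SP m n)) _).symm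

theorem hat_fvar_symm (j : Fin (2 * n)) :
    fvar m n j * hatSP m n = -(hatSP m n * fvar m n j) := by
  rw [hat_fvar]
  exact (neg_neg (G := Module.End ℝ (SP m n)) _).symm

theorem superLap_hat : Commute (superLap m n) (hatSP m n) := by
  unfold superLap
  refine Commute.sub_left (R := Module.End ℝ (SP m n)) (Commute.sum_left _ _ _ fun i _ => ?_)
    (Commute.smul_left (Commute.sum_left _ _ _ fun i _ => ?_) _)
  · exact (bder_hat i).mul_left (bder_hat i)
  · exact anti_comm_mul (A := Module.End ℝ (SP m n)) (hat_fder_symm _) (hat_fder_symm _)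

theorem superEuler_hat : Commute (superEuler m n) (hatSP m n) := by
  unfold superEuler
  refine Commute.add_left (Commute.sum_left _ _ _ fun i _ => ?_)
    (Commute.sum_left _ _ _ fun i _ => ?_)
  · exact (bvar_hat i).mul_left (bder_hat i)
  · exact anti_comm_mul (A := Module.End ℝ (SP m n)) (hat_fvar_symm _) (hat_fder_symm _)

theorem bder_superEuler (i : Fin m) :
    bder m n i * superEuler m n = superEuler m n * bder m n i + bder m n i := by
  unfold superEuler
  have h1 : ∀ j : Fin m, bder m n i * (bvar m n j * bder m n j)
      = (if i = j then bder m n j else 0) + bvar m n j * bder m n j * bder m n i := by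
    intro j
    rw [← mul_assoc, bder_bvar, add_mul, mul_assoc, (bder_bder i j).eq, ← mul_assoc]
    split_ifs <;> simp
  have h2 : ∀ j : Fin (2 * n), bder m n i * (fvar m n j * fderSP m n j)
      = fvar m n j * fderSP m n j * bder m n i := by
    intro j
    exact ((bder_fvar i j).mul_right (bder_fder i j)).eq
  rw [mul_add, add_mul, Finset.mul_sum, Finset.mul_sum, Finset.sum_mul, Finset.sum_mul,
    Finset.sum_congr rfl fun j _ => h1 j, Finset.sum_congr rfl fun j _ => h2 j,
    Finset.sum_add_distrib, Finset.sum_ite_eq, if_pos (Finset.mem_univ i)]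
  abel

theorem fder_superEuler (i : Fin (2 * n)) :
    fderSP m n i * superEuler m n = superEuler m n * fderSP m n i + fderSP m n i := by
  unfold superEuler
  have h1 : ∀ j : Fin (2 * n), fderSP m n i * (fvar m n j * fderSP m n j)
      = (if i = j then fderSP m n j else 0) + fvar m n j * fderSP m n j * fderSP m n i := by
    intro j
    refine anti_aux (A := Module.End ℝ (SP m n)) ?_ (fder_fvar i j) (fder_fder i j)
    split_ifs <;> simp
  have h2 : ∀ j : Fin m, fderSP m n i * (bvar m n j * bder m n j)
      = bvar m n j * bder m n j * fderSP m n i := by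
    intro j
    exact ((bvar_fder j i).symm.mul_right (bder_fder j i).symm).eq
  rw [mul_add, add_mul, Finset.mul_sum, Finset.mul_sum, Finset.sum_mul, Finset.sum_mul,
    Finset.sum_congr rfl fun j _ => h1 j, Finset.sum_congr rfl fun j _ => h2 j,
    Finset.sum_add_distrib, Finset.sum_ite_eq, if_pos (Finset.mem_univ i)]
  abel

variable (m n)

/-- Harmonics of real degree `r`. -/
def HarmR (r : ℝ) : Submodule ℝ (SP m n) :=
  Module.End.eigenspace (superEuler m n) r ⊓ LinearMap.ker (superLap m n)

variable {m n}

theorem mem_HarmR {r : ℝ} {f : SP m n} :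
    f ∈ HarmR m n r ↔ superEuler m n f = r • f ∧ superLap m n f = 0 := by
  unfold HarmR
  rw [Submodule.mem_inf, Module.End.mem_eigenspace_iff, LinearMap.mem_ker]

theorem lower_mem {r : ℝ} {f : SP m n} (D : Module.End ℝ (SP m n))
    (h1 : D * superEuler m n = superEuler m n * D + D) (h2 : Commute (superLap m n) D)
    (hf : f ∈ HarmR m n r) : D f ∈ HarmR m n (r - 1) := by
  rw [mem_HarmR] at hf ⊢
  have e1 := LinearMap.congr_fun h1 f
  have e2 := LinearMap.congr_fun h2.eq f
  simp only [Module.End.mul_apply, LinearMap.add_apply, hf.1, hf.2, map_smul, map_zero] at e1 e2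
  refine ⟨?_, e2⟩
  have e3 : (r - 1) • D f = r • D f - (1 : ℝ) • D f := sub_smul (M := SP m n) r 1 (D f)
  rw [e3, one_smul, e1]
  exact (add_sub_cancel_right (G := SP m n) _ _).symm

theorem hat_mem {r : ℝ} {f : SP m n} (hf : f ∈ HarmR m n r) : hatSP m n f ∈ HarmR m n r := by
  rw [mem_HarmR] at hf ⊢
  have e1 := LinearMap.congr_fun superEuler_hat.eq f
  have e2 := LinearMap.congr_fun superLap_hat.eq f
  simp only [Module.End.mul_apply, hf.1, hf.2, map_smul, map_zero] at e1 e2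
  exact ⟨e1, e2⟩

theorem superLap_mem {r s : ℝ} {u : SP m n} (hu : u ∈ HarmR m n r * HarmR m n s) :
    superLap m n u ∈ HarmR m n (r - 1) * HarmR m n (s - 1) := by
  induction hu using Submodule.mul_induction_on' with
  | add x _ y _ hx hy => rw [map_add]; exact add_mem hx hy
  | mem_mul_mem f hf g hg =>
    rw [superLap_mul, (mem_HarmR.1 hf).2, (mem_HarmR.1 hg).2, zero_mul, mul_zero, zero_add,
      zero_add]
    have hb := fun i => lower_mem (bder m n i) (bder_superEuler i) (superLap_bder i) hf
    have hb' := fun i => lower_mem (bder m n i) (bder_superEuler i) (superLap_bder i) hg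
    have hc := fun i => hat_mem
      (lower_mem (fderSP m n i) (fder_superEuler i) (superLap_fder i) hf)
    have hc' := fun i => lower_mem (fderSP m n i) (fder_superEuler i) (superLap_fder i) hg
    refine sub_mem (Submodule.smul_mem _ _ (sum_mem fun i _ => ?_))
      (Submodule.smul_mem _ _ (sum_mem fun i _ => ?_))
    · exact Submodule.mul_mem_mul (hb i) (hb' i)
    · exact sub_mem (Submodule.mul_mem_mul (hc _) (hc' _)) (Submodule.mul_mem_mul (hc _) (hc' _))

theorem superLap_pow_mem {r s : ℝ} {u : SP m n} (hu : u ∈ HarmR m n r * HarmR m n s) (j : ℕ) :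
    ((superLap m n) ^ j) u ∈ HarmR m n (r - j) * HarmR m n (s - j) := by
  induction j with
  | zero => simpa using hu
  | succ j ih =>
    rw [pow_succ', Module.End.mul_apply]
    have := superLap_mem ih
    rw [sub_sub, sub_sub] at this
    rwa [Nat.cast_add, Nat.cast_one]

theorem scalarPart_bvar (i : Fin m) (f : SP m n) : scalarPart m n (bvar m n i f) = 0 := by
  unfold scalarPart bvar
  induction f using TensorProduct.induction_on with
  | zero => simp
  | add a b ha hb => simp only [map_add, ha, hb, add_zero]
  | tmul p a => simp

theorem scalarPart_fvar (j : Fin (2 * n)) (f : SP m n) :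
    scalarPart m n (fvar m n j f) = 0 := by
  unfold scalarPart fvar
  induction f using TensorProduct.induction_on with
  | zero => simp
  | add a b ha hb => simp only [map_add, ha, hb, add_zero]
  | tmul p a =>
    have : ExteriorAlgebra.algebraMapInv (gGen j : GrassAlg (2 * n)) = (0 : ℝ) := by
      simp [gGen, ExteriorAlgebra.algebraMapInv]
    simp [this]

theorem scalarPart_eq_zero {r : ℝ} (hr : r ≠ 0) {f : SP m n} (hf : f ∈ HarmR m n r) :
    scalarPart m n f = 0 := by
  have h : scalarPart m n (superEuler m n f) = 0 := by
    unfold superEuler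
    simp [LinearMap.sum_apply, scalarPart_bvar, scalarPart_fvar]
  rw [(mem_HarmR.1 hf).1, map_smul, smul_eq_mul] at h
  exact (mul_eq_zero.1 h).resolve_left hr

theorem scalarPart_mul_eq_zero {r s : ℝ} (h : r ≠ s) {u : SP m n}
    (hu : u ∈ HarmR m n r * HarmR m n s) : scalarPart m n u = 0 := by
  induction hu using Submodule.mul_induction_on' with
  | add x _ y _ hx hy => rw [map_add, hx, hy, add_zero]
  | mem_mul_mem f hf g hg =>
    rw [map_mul]
    by_cases hr : r = 0
    · rw [scalarPart_eq_zero (fun hs => h (hr.trans hs.symm)) hg, mul_zero]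
    · rw [scalarPart_eq_zero hr hf, zero_mul]

/-- the Pizzetti integral vanishes on products of spherical
harmonics of distinct degrees. -/
theorem pizzetti_orthogonality (m n k l : ℕ) (hkl : k ≠ l)
    (Hk : SP m n) (hHk : Hk ∈ Harm m n k)
    (Hl : SP m n) (hHl : Hl ∈ Harm m n l) :
    pizzetti m n (Hk * Hl) = 0 := by
  have hmem : Hk * Hl ∈ HarmR m n (k : ℝ) * HarmR m n (l : ℝ) :=
    Submodule.mul_mem_mul hHk hHl
  have hz : ∀ j : ℕ, scalarPart m n (((superLap m n) ^ j) (Hk * Hl)) = 0 := by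
    intro j
    refine scalarPart_mul_eq_zero (fun h => hkl ?_) (superLap_pow_mem hmem j)
    exact_mod_cast sub_left_injective h
  unfold pizzetti
  simp only [hz, mul_zero, tsum_zero]

end
end
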